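/- arXiv:math/0412033 — 3 statements merged into one kernel-verified Lean document; each statement's English description precedes it below -/
import Mathlib

section
/- Let K be a field of characteristic p where p = 7ℓ+2 is prime. Then in the polynomial ring K[x,y], the monomial x^{3p} y^{3p} does not belong to the ideal generated by x^{4p}, y^{4p}, and (x^7+y^7)^{4ℓ+1}. -/
open MvPolynomial

theorem sum_neg_one_pow_mul_choose_mul_eval_eq_zero {R : Type*} [CommRing R] {P : Polynomial R}
    {N : ℕ} (hP : P.natDegree < N) (t : ℕ) :
    ∑ m ∈ Finset.range (N + 1), (-1 : R) ^ (t + m) * N.choose m * P.eval ((t + m : ℕ) : R) = 0 := by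
  have h := congrFun (Polynomial.fwdDiff_iter_eq_zero_of_degree_lt hP) (t : R)
  rw [fwdDiff_iter_eq_sum_shift, Pi.zero_apply] at h
  rw [← mul_zero ((-1 : R) ^ (t + N)), ← h, Finset.mul_sum]
  refine Finset.sum_congr rfl fun m hm => ?_
  obtain ⟨k, rfl⟩ := Nat.exists_eq_add_of_le (Nat.lt_succ_iff.mp (Finset.mem_range.mp hm))
  have hk : (-1 : R) ^ k * (-1) ^ k = 1 := by rw [← mul_pow]; simp
  simp only [zsmul_eq_mul, nsmul_eq_mul, Nat.add_sub_cancel_left]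
  push_cast
  rw [mul_one]
  linear_combination (-(-1 : R) ^ (t + m) * ((m + k).choose m) * P.eval ((t : R) + m)) * hk

/-- The polynomial of degree `2 * n` vanishing at `0, …, n - 1` and at `2 * n + 1, …, 3 * n`. -/
noncomputable def gapPolynomial (R : Type*) [CommRing R] (n : ℕ) : Polynomial R :=
  ∏ i ∈ Finset.range n,
    ((Polynomial.X - Polynomial.C (i : R)) * (Polynomial.X - Polynomial.C ((2 * n + 1 + i : ℕ) : R)))

theorem natDegree_gapPolynomial_lt (R : Type*) [CommRing R] (n : ℕ) :
    (gapPolynomial R n).natDegree < 2 * n + 1 := by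
  refine Nat.lt_succ_of_le ((Polynomial.natDegree_prod_le _ _).trans ?_)
  refine (Finset.sum_le_card_nsmul _ _ 2 fun i _ => ?_).trans (by simp [mul_comm])
  exact Polynomial.natDegree_mul_le_of_le (m := 1) (n := 1)
    (Polynomial.natDegree_X_sub_C_le _) (Polynomial.natDegree_X_sub_C_le _)

theorem eval_gapPolynomial_eq_zero (R : Type*) [CommRing R] {n t : ℕ}
    (h : t < n ∨ 2 * n + 1 ≤ t ∧ t ≤ 3 * n) : (gapPolynomial R n).eval (t : R) = 0 := by
  rw [gapPolynomial, Polynomial.eval_prod]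
  obtain h | ⟨h₁, h₂⟩ := h
  · exact Finset.prod_eq_zero (Finset.mem_range.mpr h) (by simp)
  · obtain ⟨j, rfl⟩ := Nat.exists_eq_add_of_le h₁
    exact Finset.prod_eq_zero (Finset.mem_range.mpr (by omega : j < n)) (by simp)

theorem eval_gapPolynomial_ne_zero {K : Type*} [Field K] (p : ℕ) [CharP K p] {n t : ℕ}
    (h₁ : n ≤ t) (h₂ : t ≤ 2 * n) (h₃ : t < p) (h₄ : 3 * n < p + t) :
    (gapPolynomial K n).eval (t : K) ≠ 0 := by
  have cast_sub_ne_zero {a b : ℕ} (hab : a < b) (hb : b < p + a) : (b : K) - a ≠ 0 := by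
    rw [← Nat.cast_sub hab.le, Ne, CharP.cast_eq_zero_iff K p]
    exact Nat.not_dvd_of_pos_of_lt (by omega) (by omega)
  rw [gapPolynomial, Polynomial.eval_prod, Finset.prod_ne_zero_iff]
  intro i hi
  have hi' := Finset.mem_range.mp hi
  simp only [Polynomial.eval_mul, Polynomial.eval_sub, Polynomial.eval_X, Polynomial.eval_C]
  refine mul_ne_zero (cast_sub_ne_zero (by omega) (by omega)) ?_
  rw [← neg_ne_zero, neg_sub]
  exact cast_sub_ne_zero (by omega) (by omega)

/-- The linear functional on `K[x, y]` which, on the monomials `x ^ (7 * t + 6) * y ^ (7 * s + 6)`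
with `t + s = D`, takes the value `(-1) ^ t * P(t)`, and is zero on all other monomials. -/
noncomputable def weightFunctional {K : Type*} [Field K] (D : ℕ) (P : Polynomial K) :
    MvPolynomial (Fin 2) K →ₗ[K] K :=
  (basisMonomials (Fin 2) K).constr K fun d =>
    if d 0 % 7 = 6 ∧ d 1 % 7 = 6 ∧ d 0 / 7 + d 1 / 7 = D then
      (-1) ^ (d 0 / 7) * P.eval ((d 0 / 7 : ℕ) : K)
    else 0

theorem weightFunctional_X_pow_mul_X_pow {K : Type*} [Field K] (D : ℕ) (P : Polynomial K)
    (a b : ℕ) :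
    weightFunctional D P (X 0 ^ a * X 1 ^ b) =
      if a % 7 = 6 ∧ b % 7 = 6 ∧ a / 7 + b / 7 = D then
        (-1) ^ (a / 7) * P.eval ((a / 7 : ℕ) : K)
      else 0 := by
  have h : (X 0 ^ a * X 1 ^ b : MvPolynomial (Fin 2) K) =
      basisMonomials (Fin 2) K (Finsupp.single 0 a + Finsupp.single 1 b) := by
    simp [coe_basisMonomials, X_pow_eq_monomial, monomial_mul]
  rw [h, weightFunctional, Module.Basis.constr_basis]
  simp

theorem map_mul_eq_zero_of_forall_monomial {K M : Type*} [Field K] [AddCommGroup M] [Module K M]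
    (L : MvPolynomial (Fin 2) K →ₗ[K] M) (g : MvPolynomial (Fin 2) K)
    (h : ∀ a b : ℕ, L (X 0 ^ a * X 1 ^ b * g) = 0) (f : MvPolynomial (Fin 2) K) :
    L (f * g) = 0 := by
  induction f using MvPolynomial.induction_on' with
  | monomial d c =>
    have hd : (monomial d c : MvPolynomial (Fin 2) K) = c • (X 0 ^ d 0 * X 1 ^ d 1) := by
      rw [monomial_eq, Finsupp.prod_fintype _ _ (by simp), Fin.prod_univ_two, smul_eq_C_mul]
    rw [hd, smul_mul_assoc, map_smul, h, smul_zero]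
  | add f₁ f₂ h₁ h₂ => rw [add_mul, map_add, h₁, h₂, add_zero]

theorem weightFunctional_mul_add_pow {K : Type*} [Field K] (D : ℕ) {P : Polynomial K} {N : ℕ}
    (hP : P.natDegree < N) (f : MvPolynomial (Fin 2) K) :
    weightFunctional D P (f * (X 0 ^ 7 + X 1 ^ 7) ^ N) = 0 := by
  refine map_mul_eq_zero_of_forall_monomial _ _ (fun a b => ?_) f
  have hterm : ∀ m ∈ Finset.range (N + 1),
      weightFunctional D P (X 0 ^ a * X 1 ^ b *
        ((X 0 ^ 7) ^ m * (X 1 ^ 7) ^ (N - m) * (N.choose m : MvPolynomial (Fin 2) K))) =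
      if a % 7 = 6 ∧ b % 7 = 6 ∧ a / 7 + b / 7 + N = D then
        (-1) ^ (a / 7 + m) * (N.choose m : K) * P.eval ((a / 7 + m : ℕ) : K)
      else 0 := by
    intro m hm
    have hm' := Finset.mem_range.mp hm
    have h : (X 0 ^ a * X 1 ^ b *
        ((X 0 ^ 7) ^ m * (X 1 ^ 7) ^ (N - m) * (N.choose m : MvPolynomial (Fin 2) K))) =
        (N.choose m : K) • (X 0 ^ (a + 7 * m) * X 1 ^ (b + 7 * (N - m))) := by
      rw [smul_eq_C_mul, map_natCast]
      ring
    have hcond : ((a + 7 * m) % 7 = 6 ∧ (b + 7 * (N - m)) % 7 = 6 ∧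
        (a + 7 * m) / 7 + (b + 7 * (N - m)) / 7 = D) ↔
        (a % 7 = 6 ∧ b % 7 = 6 ∧ a / 7 + b / 7 + N = D) := by omega
    have hdiv : (a + 7 * m) / 7 = a / 7 + m := by omega
    rw [h, map_smul, weightFunctional_X_pow_mul_X_pow, if_congr hcond rfl rfl, hdiv, smul_eq_mul,
      mul_ite, mul_zero]
    congr 1
    ring
  rw [add_pow, Finset.mul_sum, map_sum, Finset.sum_congr rfl hterm]
  split_ifs
  · exact sum_neg_one_pow_mul_choose_mul_eval_eq_zero hP _
  · exact Finset.sum_const_zero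

/-- For p = 7ℓ+2 prime and char K = p, in K[x,y] one has
x^{3p} y^{3p} ∉ (x^{4p}, y^{4p}, (x^7+y^7)^{4ℓ+1}). -/
theorem nonmembership_2mod7 {K : Type*} [Field K] (p ℓ : ℕ) (hp : p.Prime)
    (hpl : p = 7 * ℓ + 2) [CharP K p] :
    (X 0 : MvPolynomial (Fin 2) K) ^ (3 * p) * X 1 ^ (3 * p) ∉
      Ideal.span {(X 0 : MvPolynomial (Fin 2) K) ^ (4 * p), X 1 ^ (4 * p),
        (X 0 ^ 7 + X 1 ^ 7) ^ (4 * ℓ + 1)} := by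
  intro hmem
  obtain ⟨f, _, hz, hf⟩ := Ideal.mem_span_insert.mp hmem
  obtain ⟨g, h, rfl⟩ := Ideal.mem_span_pair.mp hz
  set L := weightFunctional (6 * ℓ) (gapPolynomial K (2 * ℓ)) with hL
  have hx : L (f * X 0 ^ (4 * p)) = 0 := by
    refine map_mul_eq_zero_of_forall_monomial _ _ (fun a b => ?_) f
    rw [mul_right_comm, ← pow_add, hL, weightFunctional_X_pow_mul_X_pow]
    split_ifs
    · rw [eval_gapPolynomial_eq_zero K (by omega), mul_zero]
    · rfl
  have hy : L (g * X 1 ^ (4 * p)) = 0 := by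
    refine map_mul_eq_zero_of_forall_monomial _ _ (fun a b => ?_) g
    rw [mul_assoc, ← pow_add, hL, weightFunctional_X_pow_mul_X_pow]
    split_ifs
    · rw [eval_gapPolynomial_eq_zero K (by omega), mul_zero]
    · rfl
  have hxy : L (h * (X 0 ^ 7 + X 1 ^ 7) ^ (4 * ℓ + 1)) = 0 :=
    weightFunctional_mul_add_pow _
      ((natDegree_gapPolynomial_lt K (2 * ℓ)).trans_eq (by ring)) h
  have hzero : L (X 0 ^ (3 * p) * X 1 ^ (3 * p)) = 0 := by
    rw [hf, map_add, map_add, hx, hy, hxy, add_zero, add_zero]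
  rw [hL, weightFunctional_X_pow_mul_X_pow, if_pos (by omega)] at hzero
  exact mul_ne_zero (pow_ne_zero _ (neg_ne_zero.mpr one_ne_zero))
    (eval_gapPolynomial_ne_zero p (by omega) (by omega) (by omega) (by omega)) hzero
end

section
/- Let K be a field of characteristic p where p = 7ℓ+3 is prime. Then in the polynomial ring K[x,y], the monomial x^{7(3ℓ+1)} y^{7(3ℓ+1)} belongs to the ideal generated by x^{28ℓ+12}, y^{28ℓ+12}, and (x^7+y^7)^{4ℓ+2}. -/
open MvPolynomial

namespace Polynomial

section Membership

variable {K : Type*} [Field K]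

lemma degree_mul_lt_three_mul {n : ℕ} {A P : K[X]} (hA : A.degree < n)
    (hP : P.degree ≤ (2 * n : ℕ)) : (A * P).degree < (3 * n : ℕ) := by
  by_cases hA0 : A = 0
  · rw [hA0, zero_mul, degree_zero]; exact WithBot.bot_lt_coe _
  by_cases hP0 : P = 0
  · rw [hP0, mul_zero, degree_zero]; exact WithBot.bot_lt_coe _
  rw [← natDegree_lt_iff_degree_lt hA0] at hA
  rw [← natDegree_le_iff_degree_le] at hP
  rw [← natDegree_lt_iff_degree_lt (mul_ne_zero hA0 hP0), natDegree_mul hA0 hP0]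
  omega

lemma degree_lt_of_iterate_derivative_eq_zero (p : ℕ) [Fact p.Prime] [CharP K p] {n : ℕ}
    {f : K[X]} (hf : f.degree < p) (h : derivative^[n] f = 0) : f.degree < n := by
  rw [degree_lt_iff_coeff_zero] at hf ⊢
  intro m hm
  by_cases hmp : p ≤ m
  · exact hf m hmp
  have hc := coeff_iterate_derivative (k := n) f (m - n)
  rw [h, coeff_zero, Nat.sub_add_cancel hm, nsmul_eq_mul] at hc
  refine (mul_eq_zero.mp hc.symm).resolve_left fun h0 => ?_
  rw [CharP.cast_eq_zero_iff K p] at h0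
  have hdvd : p ∣ m.factorial := h0.trans
    ⟨(m - n).factorial, by rw [mul_comm, Nat.factorial_mul_descFactorial hm]⟩
  exact hmp ((Fact.out : p.Prime).dvd_factorial.mp hdvd)

lemma eq_zero_of_iterate_derivative_mul_eq_zero (p : ℕ) [Fact p.Prime] [CharP K p] {n : ℕ}
    (hnp : 3 * n ≤ p) {A P : K[X]} (hA : A.degree < n) (hP : P.degree = (2 * n : ℕ))
    (h : derivative^[n] (A * P) = 0) : A = 0 := by
  by_contra hA0
  have hlt := degree_lt_of_iterate_derivative_eq_zero p
    ((degree_mul_lt_three_mul hA hP.le).trans_le (by exact_mod_cast hnp)) h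
  have hP0 : P ≠ 0 := by
    rintro rfl
    exact WithBot.bot_ne_coe hP
  rw [← natDegree_lt_iff_degree_lt (mul_ne_zero hA0 hP0), natDegree_mul hA0 hP0,
    natDegree_eq_of_degree_eq_some hP] at hlt
  omega

lemma degree_X_add_one_pow (m : ℕ) : ((X + 1 : K[X]) ^ m).degree = m := by
  rw [degree_pow, ← C_1, degree_X_add_C, nsmul_one]

/-- There is no nontrivial syzygy of degree less than `n` among `X ^ (2 * n)`, `1` and
`(X + 1) ^ (2 * n)` in characteristic `p ≥ 3 * n`. -/
lemma eq_zero_of_syzygy (p : ℕ) [Fact p.Prime] [CharP K p] {n : ℕ} (hnp : 3 * n ≤ p)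
    {A B D : K[X]} (hA : A.degree < n) (hB : B.degree < n) (hD : D.degree < n)
    (h : A * X ^ (2 * n) + B + D * (X + 1) ^ (2 * n) = 0) : A = 0 ∧ B = 0 ∧ D = 0 := by
  have hdeg {P : K[X]} (hP : P.degree < (3 * n : ℕ)) :
      (derivative^[n] P).degree < (2 * n : ℕ) := by
    rw [degree_lt_iff_coeff_zero] at hP ⊢
    intro m hm
    rw [coeff_iterate_derivative, hP _ (by omega), smul_zero]
  have hdB : derivative^[n] B = 0 := by
    ext m
    rw [coeff_iterate_derivative, (degree_lt_iff_coeff_zero _ _).mp hB _ (by omega), smul_zero,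
      coeff_zero]
  have hsum : derivative^[n] (A * X ^ (2 * n)) + derivative^[n] (D * (X + 1) ^ (2 * n)) = 0 := by
    have := congrArg (derivative^[n]) h
    simpa only [iterate_map_add, hdB, add_zero, iterate_map_zero] using this
  have hdA : derivative^[n] (A * X ^ (2 * n)) = 0 := by
    have hX : (X : K[X]) ^ n ∣ derivative^[n] (A * X ^ (2 * n)) := by
      have := pow_sub_dvd_iterate_derivative_of_pow_dvd n
        (dvd_mul_left ((X : K[X]) ^ (2 * n)) A)
      rwa [show 2 * n - n = n by omega] at this
    have hX1 : (X + 1 : K[X]) ^ n ∣ derivative^[n] (A * X ^ (2 * n)) := by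
      have := pow_sub_dvd_iterate_derivative_of_pow_dvd n
        (dvd_mul_left ((X + 1 : K[X]) ^ (2 * n)) D)
      rwa [show 2 * n - n = n by omega, ← dvd_neg, ← eq_neg_of_add_eq_zero_left hsum] at this
    have hcop : IsCoprime (X : K[X]) (X + 1) := ⟨-1, 1, by ring⟩
    refine eq_zero_of_dvd_of_degree_lt ((hcop.pow (m := n) (n := n)).mul_dvd hX hX1) ?_
    rw [degree_mul, degree_X_pow, degree_X_add_one_pow, ← Nat.cast_add, ← two_mul]
    exact hdeg (degree_mul_lt_three_mul hA (degree_X_pow _).le)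
  have hA0 := eq_zero_of_iterate_derivative_mul_eq_zero p hnp hA (degree_X_pow _) hdA
  rw [hdA, zero_add] at hsum
  have hD0 := eq_zero_of_iterate_derivative_mul_eq_zero p hnp hD (degree_X_add_one_pow _) hsum
  exact ⟨hA0, by simpa [hA0, hD0] using h, hD0⟩

lemma exists_eq_mul_X_pow_add_add_mul_X_add_one_pow (p : ℕ) [Fact p.Prime] [CharP K p] {n : ℕ}
    (hnp : 3 * n ≤ p) {f : K[X]} (hf : f.degree < (3 * n : ℕ)) :
    ∃ A B D : K[X], A.degree < n ∧ B.degree < n ∧ D.degree < n ∧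
      f = A * X ^ (2 * n) + B + D * (X + 1) ^ (2 * n) := by
  let V := degreeLT K n
  let φ : V × V × V →ₗ[K] K[X] :=
    (LinearMap.mulRight K (X ^ (2 * n)) ∘ₗ V.subtype).coprod
      (V.subtype.coprod (LinearMap.mulRight K ((X + 1) ^ (2 * n)) ∘ₗ V.subtype))
  have hφ (v : V × V × V) :
      φ v = (v.1 : K[X]) * X ^ (2 * n) + (v.2.1 : K[X]) + (v.2.2 : K[X]) * (X + 1) ^ (2 * n) := by
    simp [φ, add_assoc]
  have hV (v : V) : (v : K[X]).degree < n := mem_degreeLT.mp v.2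
  have hmem (v : V × V × V) : φ v ∈ degreeLT K (3 * n) := by
    rw [hφ]
    refine add_mem (add_mem ?_ ?_) ?_ <;> rw [mem_degreeLT]
    · exact degree_mul_lt_three_mul (hV _) (degree_X_pow _).le
    · exact (hV _).trans_le (by exact_mod_cast (by omega : n ≤ 3 * n))
    · exact degree_mul_lt_three_mul (hV _) (degree_X_add_one_pow _).le
  have hinj : Function.Injective (φ.codRestrict _ hmem) := by
    rw [injective_iff_map_eq_zero]
    intro v hv
    have h0 : φ v = 0 := congrArg Subtype.val hv
    rw [hφ] at h0
    obtain ⟨h1, h2, h3⟩ := eq_zero_of_syzygy p hnp (hV _) (hV _) (hV _) h0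
    exact Prod.ext (Subtype.ext h1) (Prod.ext (Subtype.ext h2) (Subtype.ext h3))
  have hrank (m : ℕ) : Module.finrank K (degreeLT K m) = m := by
    simpa using (degreeLTEquiv K m).finrank_eq
  have (m : ℕ) : FiniteDimensional K (degreeLT K m) :=
    Module.Finite.equiv (degreeLTEquiv K m).symm
  have hsurj := (LinearMap.injective_iff_surjective_of_finrank_eq_finrank
    (by simp only [Module.finrank_prod, V, hrank]; ring)).mp hinj
  obtain ⟨v, hv⟩ := hsurj ⟨f, mem_degreeLT.mpr hf⟩
  exact ⟨v.1, v.2.1, v.2.2, hV _, hV _, hV _, by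
    rw [← hφ]; exact (congrArg Subtype.val hv).symm⟩

lemma homogenize_X_add_one_pow (m : ℕ) :
    homogenize ((X + 1 : K[X]) ^ m) m = (MvPolynomial.X 0 + MvPolynomial.X 1) ^ m := by
  apply homogenize_eq_of_isHomogeneous
  · simpa using ((isHomogeneous_X K (0 : Fin 2)).add (isHomogeneous_X K 1)).pow m
  · simp

end Membership

end Polynomial

/-- In characteristic `p ≥ 3 * n`, every monomial of degree `3 * n - 1` in `u` and `v` lies in
the ideal `(u ^ (2 * n), v ^ (2 * n), (u + v) ^ (2 * n))`. -/
lemma pow_mul_pow_mem_span_of_char {K R : Type*} [Field K] [CommRing R] [Algebra K R]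
    (p : ℕ) [Fact p.Prime] [CharP K p] {n i j : ℕ} (hnp : 3 * n ≤ p) (hij : i + j + 1 = 3 * n)
    (u v : R) :
    u ^ i * v ^ j ∈ Ideal.span {u ^ (2 * n), v ^ (2 * n), (u + v) ^ (2 * n)} := by
  obtain ⟨A, B, D, hA, hB, hD, h⟩ :=
    Polynomial.exists_eq_mul_X_pow_add_add_mul_X_add_one_pow (K := K) p hnp
      (f := Polynomial.X ^ i) (by
        rw [Polynomial.degree_X_pow]; exact_mod_cast (by omega : i < 3 * n))
  have hle {P : Polynomial K} (hP : P.degree < n) : P.natDegree ≤ n - 1 :=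
    Polynomial.natDegree_le_iff_coeff_eq_zero.mpr fun m hm =>
      (Polynomial.degree_lt_iff_coeff_zero _ _).mp hP m (by omega)
  have hhom := congrArg (fun P => aeval ![u, v] (P.homogenize (n - 1 + 2 * n))) h
  rw [← mul_one B] at hhom
  simp only [Polynomial.homogenize_add] at hhom
  rw [Polynomial.homogenize_X_pow (by omega),
    Polynomial.homogenize_mul _ _ (hle hA) (by simp),
    Polynomial.homogenize_mul _ _ (hle hB) (by simp),
    Polynomial.homogenize_mul _ _ (hle hD)
      (Polynomial.natDegree_eq_of_degree_eq_some (Polynomial.degree_X_add_one_pow _)).le,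
    Polynomial.homogenize_X_pow le_rfl, Polynomial.homogenize_one,
    Polynomial.homogenize_X_add_one_pow, show n - 1 + 2 * n - i = j by omega] at hhom
  simp only [map_mul, map_add, map_pow, aeval_X, Matrix.cons_val_zero, Matrix.cons_val_one,
    Nat.sub_self, pow_zero, mul_one] at hhom
  rw [hhom]
  refine add_mem (add_mem ?_ ?_) ?_ <;>
    exact Ideal.mul_mem_left _ _ (Ideal.subset_span (by simp))

/-- For p = 7ℓ+3 prime and char K = p, in K[x,y] one has
x^{7(3ℓ+1)} y^{7(3ℓ+1)} ∈ (x^{28ℓ+12}, y^{28ℓ+12}, (x^7+y^7)^{4ℓ+2}). -/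
theorem membership_3mod7 {K : Type*} [Field K] (p ℓ : ℕ) (hp : p.Prime)
    (hpl : p = 7 * ℓ + 3) [CharP K p] :
    (X 0 : MvPolynomial (Fin 2) K) ^ (7 * (3 * ℓ + 1)) * X 1 ^ (7 * (3 * ℓ + 1)) ∈
      Ideal.span {(X 0 : MvPolynomial (Fin 2) K) ^ (28 * ℓ + 12), X 1 ^ (28 * ℓ + 12),
        (X 0 ^ 7 + X 1 ^ 7) ^ (4 * ℓ + 2)} := by
  have : Fact p.Prime := ⟨hp⟩
  have h := pow_mul_pow_mem_span_of_char (K := K) p (n := 2 * ℓ + 1) (i := 3 * ℓ + 1)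
    (j := 3 * ℓ + 1) (by omega) (by omega) (X 0 ^ 7 : MvPolynomial (Fin 2) K) (X 1 ^ 7)
  simp only [← pow_mul] at h ⊢
  refine Ideal.span_le.mpr ?_ h
  rintro _ (rfl | rfl | rfl)
  · exact Ideal.mem_of_dvd _
      (pow_dvd_pow _ (by omega : 28 * ℓ + 12 ≤ 7 * (2 * (2 * ℓ + 1)))) (Ideal.subset_span (by simp))
  · exact Ideal.mem_of_dvd _
      (pow_dvd_pow _ (by omega : 28 * ℓ + 12 ≤ 7 * (2 * (2 * ℓ + 1)))) (Ideal.subset_span (by simp))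
  · exact Ideal.subset_span (by simp [show 2 * (2 * ℓ + 1) = 4 * ℓ + 2 by ring])
end

section
/- Let K be a field of characteristic p where p = 7ℓ+2 is prime and ℓ ≥ 1. Then in K[x,y], the monomial x^{3p²} y^{3p²} does not belong to the ideal generated by x^{4p²}, y^{4p²}, and (x^7+y^7)^{4k+2}, where k = 7ℓ²+4ℓ. -/
open MvPolynomial

/-- The pairing of `u ^ i * v ^ j` with the form `U ^ (2ℓ) * V ^ (2ℓ) * (U - V) ^ (2ℓ)`, where
`u` and `v` act as `∂/∂U` and `∂/∂V`. -/
def apolarWeight (ℓ i j : ℕ) : ℤ :=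
  if i + j = 6 * ℓ ∧ 2 * ℓ ≤ i then
    (-1) ^ i * (i.factorial * j.factorial * (2 * ℓ).choose (i - 2 * ℓ)) else 0

lemma apolarWeight_of_left_gt {ℓ i : ℕ} (j : ℕ) (h : 4 * ℓ < i) : apolarWeight ℓ i j = 0 := by
  unfold apolarWeight
  split_ifs
  · rw [Nat.choose_eq_zero_of_lt (by omega)]; simp
  · rfl

lemma apolarWeight_of_right_gt {ℓ j : ℕ} (i : ℕ) (h : 4 * ℓ < j) : apolarWeight ℓ i j = 0 := by
  unfold apolarWeight
  rw [if_neg (by omega)]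

/-- An alternating binomial sum of the values of a polynomial of smaller degree vanishes. -/
lemma sum_alternating_choose_mul_descFactorial {n N a b : ℕ} (r : ℕ) (hab : a + b < n)
    (hN : r + n ≤ N) :
    ∑ m ∈ Finset.range (n + 1), (-1 : ℤ) ^ (n - m) * n.choose m *
      ((r + m).descFactorial a * (N - (r + m)).descFactorial b) = 0 := by
  have hdeg : (descPochhammer ℤ a * (descPochhammer ℤ b).comp
      (Polynomial.C (N : ℤ) - Polynomial.X)).natDegree < n := by
    refine lt_of_le_of_lt (Polynomial.natDegree_mul_le.trans ?_) hab
    have h1 : (Polynomial.C (N : ℤ) - Polynomial.X).natDegree ≤ 1 := by compute_degree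
    have h2 := Polynomial.natDegree_comp_le (p := descPochhammer ℤ b)
      (q := Polynomial.C (N : ℤ) - Polynomial.X)
    rw [descPochhammer_natDegree] at h2 ⊢
    nlinarith
  have h := congrFun (Polynomial.fwdDiff_iter_eq_zero_of_degree_lt hdeg) (r : ℤ)
  rw [fwdDiff_iter_eq_sum_shift, Pi.zero_apply] at h
  rw [← h]
  refine Finset.sum_congr rfl fun m hm ↦ ?_
  have hm' : r + m ≤ N := by have := Finset.mem_range.1 hm; omega
  have e1 : (r : ℤ) + m • (1 : ℤ) = ((r + m : ℕ) : ℤ) := by simp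
  have e2 : (N : ℤ) - ((r + m : ℕ) : ℤ) = ((N - (r + m) : ℕ) : ℤ) := by
    rw [Nat.cast_sub hm']
  rw [e1, smul_eq_mul, Polynomial.eval_mul, Polynomial.eval_comp, Polynomial.eval_sub,
    Polynomial.eval_C, Polynomial.eval_X, e2, descPochhammer_eval_eq_descFactorial,
    descPochhammer_eval_eq_descFactorial]

lemma choose_mul_factorial_add_mul_factorial_add {n s : ℕ} (a b : ℕ) (hs : s ≤ n) :
    n.choose s * ((a + s).factorial * (b + (n - s)).factorial) =
      n.factorial * ((a + s).descFactorial a * (b + (n - s)).descFactorial b) := by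
  have h1 := Nat.factorial_mul_descFactorial (Nat.le_add_right a s)
  have h2 := Nat.factorial_mul_descFactorial (Nat.le_add_right b (n - s))
  rw [Nat.add_sub_cancel_left] at h1 h2
  rw [← h1, ← h2, ← Nat.choose_mul_factorial_mul_factorial hs]
  ring

/-- The pairing defined by `apolarWeight` annihilates the multiples of `(u + v) ^ (4ℓ + 1)`. -/
lemma sum_choose_mul_apolarWeight (ℓ a b : ℕ) :
    ∑ s ∈ Finset.range (4 * ℓ + 2), ((4 * ℓ + 1).choose s : ℤ) *
      apolarWeight ℓ (a + s) (b + (4 * ℓ + 1 - s)) = 0 := by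
  by_cases hab : a + b + 1 = 2 * ℓ
  · rw [show 4 * ℓ + 2 = (2 * ℓ - a) + ((2 * ℓ + 1) + (a + 1)) by omega, Finset.sum_range_add,
      Finset.sum_range_add, Finset.sum_eq_zero, zero_add, add_comm, Finset.sum_eq_zero, zero_add]
    · rw [← mul_zero ((4 * ℓ + 1).factorial : ℤ), ← sum_alternating_choose_mul_descFactorial
        (2 * ℓ) (show a + b < 2 * ℓ by omega) (show 2 * ℓ + 2 * ℓ ≤ 6 * ℓ by omega),
        Finset.mul_sum]
      refine Finset.sum_congr rfl fun m hm ↦ ?_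
      have hm' := Finset.mem_range.1 hm
      have key := choose_mul_factorial_add_mul_factorial_add a b
        (show 2 * ℓ - a + m ≤ 4 * ℓ + 1 by omega)
      have e1 : a + (2 * ℓ - a + m) = 2 * ℓ + m := by omega
      have e2 : b + (4 * ℓ + 1 - (2 * ℓ - a + m)) = 6 * ℓ - (2 * ℓ + m) := by omega
      rw [e1, e2] at key ⊢
      have e3 : (-1 : ℤ) ^ (2 * ℓ - m) = (-1) ^ (2 * ℓ + m) := by
        rw [show 2 * ℓ + m = (2 * ℓ - m) + 2 * m by omega, pow_add, pow_mul]; simp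
      zify at key
      rw [apolarWeight, if_pos (by omega), Nat.add_sub_cancel_left, e3]
      linear_combination (-1 : ℤ) ^ (2 * ℓ + m) * (2 * ℓ).choose m * key
    · intro m _
      rw [apolarWeight_of_left_gt _ (by omega), mul_zero]
    · intro m hm
      have := Finset.mem_range.1 hm
      rw [apolarWeight_of_right_gt _ (by omega), mul_zero]
  · refine Finset.sum_eq_zero fun s hs ↦ ?_
    have := Finset.mem_range.1 hs
    rw [apolarWeight, if_neg (by omega), mul_zero]

/-- The extension of `apolarWeight` to the monomials `x ^ a * y ^ b`, with `u = x ^ (7p)` and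
`v = y ^ (7p)`, supported on the multiples of `(x * y) ^ (6p)` by monomials in `u` and `v`. -/
def frobeniusWeight (p ℓ a b : ℕ) : ℤ :=
  if a % (7 * p) = 6 * p ∧ b % (7 * p) = 6 * p then
    apolarWeight ℓ (a / (7 * p)) (b / (7 * p)) else 0

lemma lt_div_of_four_mul_sq_le {p ℓ a : ℕ} (hpl : p = 7 * ℓ + 2)
    (ha : 4 * p ^ 2 ≤ a) (hmod : a % (7 * p) = 6 * p) : 4 * ℓ < a / (7 * p) := by
  by_contra! h
  have h1 := Nat.div_add_mod a (7 * p)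
  have h2 : 7 * p * (a / (7 * p)) ≤ 7 * p * (4 * ℓ) := Nat.mul_le_mul_left _ h
  have h3 : p ^ 2 = p * (7 * ℓ) + 2 * p := by rw [sq]; nth_rw 2 [hpl]; ring
  rw [hmod] at h1
  nlinarith

lemma frobeniusWeight_of_left_ge {p ℓ a : ℕ} (b : ℕ) (hpl : p = 7 * ℓ + 2)
    (ha : 4 * p ^ 2 ≤ a) : frobeniusWeight p ℓ a b = 0 := by
  unfold frobeniusWeight
  split_ifs with h
  · exact apolarWeight_of_left_gt _ (lt_div_of_four_mul_sq_le hpl ha h.1)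
  · rfl

lemma frobeniusWeight_of_right_ge {p ℓ b : ℕ} (a : ℕ) (hpl : p = 7 * ℓ + 2)
    (hb : 4 * p ^ 2 ≤ b) : frobeniusWeight p ℓ a b = 0 := by
  unfold frobeniusWeight
  split_ifs with h
  · exact apolarWeight_of_right_gt _ (lt_div_of_four_mul_sq_le hpl hb h.2)
  · rfl

lemma sum_choose_mul_frobeniusWeight {p : ℕ} (ℓ a b : ℕ) (hp : 0 < p) :
    ∑ s ∈ Finset.range (4 * ℓ + 2), ((4 * ℓ + 1).choose s : ℤ) *
      frobeniusWeight p ℓ (a + 7 * p * s) (b + 7 * p * (4 * ℓ + 1 - s)) = 0 := by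
  have hp' : 0 < 7 * p := by omega
  simp only [frobeniusWeight, Nat.add_mul_mod_self_left, Nat.add_mul_div_left _ _ hp']
  split_ifs
  · exact sum_choose_mul_apolarWeight ..
  · simp

lemma frobeniusWeight_three_mul_sq {p ℓ : ℕ} (hp : 0 < p) (hpl : p = 7 * ℓ + 2) :
    frobeniusWeight p ℓ (3 * p ^ 2) (3 * p ^ 2) =
      (-1) ^ (3 * ℓ) * ((3 * ℓ).factorial * (3 * ℓ).factorial * (2 * ℓ).choose ℓ) := by
  have hp' : 0 < 7 * p := by omega
  have h : 3 * p ^ 2 = 6 * p + 7 * p * (3 * ℓ) := by rw [sq]; nth_rw 2 [hpl]; ring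
  rw [frobeniusWeight, h, Nat.add_mul_mod_self_left, Nat.add_mul_div_left _ _ hp',
    Nat.mod_eq_of_lt (by omega), Nat.div_eq_of_lt (by omega), zero_add, if_pos ⟨rfl, rfl⟩,
    apolarWeight, if_pos (by omega), show 3 * ℓ - 2 * ℓ = ℓ by omega]

/-- The linear functional on `K[x, y]` whose values on monomials are given by
`frobeniusWeight`. -/
noncomputable def frobeniusFunctional (K : Type*) [Field K] (p ℓ : ℕ) :
    MvPolynomial (Fin 2) K →ₗ[K] K :=
  (basisMonomials (Fin 2) K).constr K fun m ↦ (frobeniusWeight p ℓ (m 0) (m 1) : K)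

section frobeniusFunctional

variable {K : Type*} [Field K] {p ℓ : ℕ}

lemma frobeniusFunctional_X_pow_mul_X_pow (a b : ℕ) :
    frobeniusFunctional K p ℓ (X 0 ^ a * X 1 ^ b) = (frobeniusWeight p ℓ a b : K) := by
  have h := (basisMonomials (Fin 2) K).constr_basis K
    (fun m ↦ (frobeniusWeight p ℓ (m 0) (m 1) : K)) (Finsupp.single 0 a + Finsupp.single 1 b)
  rw [coe_basisMonomials] at h
  rw [X_pow_eq_monomial, X_pow_eq_monomial, monomial_mul, one_mul]
  simpa [frobeniusFunctional] using h

lemma frobeniusFunctional_mul_eq_zero {h : MvPolynomial (Fin 2) K}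
    (H : ∀ a b : ℕ, frobeniusFunctional K p ℓ (X 0 ^ a * X 1 ^ b * h) = 0)
    (g : MvPolynomial (Fin 2) K) : frobeniusFunctional K p ℓ (g * h) = 0 := by
  induction g using MvPolynomial.induction_on' with
  | monomial m c =>
    rw [monomial_eq, Finsupp.prod_fintype _ _ (by simp), Fin.prod_univ_two, mul_assoc, C_mul',
      map_smul, H, smul_zero]
  | add g₁ g₂ h₁ h₂ => rw [add_mul, map_add, h₁, h₂, add_zero]

lemma frobeniusFunctional_mul_pow_eq_zero [CharP K p] (hp : p.Prime)
    (g : MvPolynomial (Fin 2) K) :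
    frobeniusFunctional K p ℓ (g * (X 0 ^ 7 + X 1 ^ 7) ^ (p * (4 * ℓ + 1))) = 0 := by
  have := Fact.mk hp
  refine frobeniusFunctional_mul_eq_zero (fun a b ↦ ?_) g
  rw [pow_mul, add_pow_char, add_pow, Finset.mul_sum, map_sum]
  have hsum := congrArg (Int.cast : ℤ → K) (sum_choose_mul_frobeniusWeight ℓ a b hp.pos)
  rw [Int.cast_sum, Int.cast_zero] at hsum
  rw [← hsum]
  refine Finset.sum_congr rfl fun s _ ↦ ?_
  rw [show (X 0 ^ a * X 1 ^ b * (((X 0 ^ 7) ^ p) ^ s * ((X 1 ^ 7) ^ p) ^ (4 * ℓ + 1 - s) *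
        ((4 * ℓ + 1).choose s : MvPolynomial (Fin 2) K)) : MvPolynomial (Fin 2) K) =
      (4 * ℓ + 1).choose s •
        (X 0 ^ (a + 7 * p * s) * X 1 ^ (b + 7 * p * (4 * ℓ + 1 - s))) by
    rw [nsmul_eq_mul]; ring, map_nsmul, frobeniusFunctional_X_pow_mul_X_pow]
  simp

end frobeniusFunctional

/-- For p = 7ℓ+2 prime, ℓ ≥ 1, char K = p and k = 7ℓ²+4ℓ, in K[x,y] one has
x^{3p²} y^{3p²} ∉ (x^{4p²}, y^{4p²}, (x^7+y^7)^{4k+2}). -/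
theorem nonmembership_psquared {K : Type*} [Field K] (p ℓ k : ℕ) (hl : 1 ≤ ℓ)
    (hp : p.Prime) (hpl : p = 7 * ℓ + 2) (hk : k = 7 * ℓ ^ 2 + 4 * ℓ) [CharP K p] :
    (X 0 : MvPolynomial (Fin 2) K) ^ (3 * p ^ 2) * X 1 ^ (3 * p ^ 2) ∉
      Ideal.span {(X 0 : MvPolynomial (Fin 2) K) ^ (4 * p ^ 2), X 1 ^ (4 * p ^ 2),
        (X 0 ^ 7 + X 1 ^ 7) ^ (4 * k + 2)} := by
  intro hmem
  obtain ⟨g₁, z, hz, h₁⟩ := Ideal.mem_span_insert.1 hmem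
  obtain ⟨g₂, w, hw, rfl⟩ := Ideal.mem_span_insert.1 hz
  obtain ⟨g₃, rfl⟩ := Ideal.mem_span_singleton'.1 hw
  have hx : frobeniusFunctional K p ℓ (g₁ * X 0 ^ (4 * p ^ 2)) = 0 := by
    refine frobeniusFunctional_mul_eq_zero (fun a b ↦ ?_) g₁
    rw [mul_right_comm, ← pow_add, frobeniusFunctional_X_pow_mul_X_pow,
      frobeniusWeight_of_left_ge _ hpl (by omega), Int.cast_zero]
  have hy : frobeniusFunctional K p ℓ (g₂ * X 1 ^ (4 * p ^ 2)) = 0 := by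
    refine frobeniusFunctional_mul_eq_zero (fun a b ↦ ?_) g₂
    rw [mul_assoc, ← pow_add, frobeniusFunctional_X_pow_mul_X_pow,
      frobeniusWeight_of_right_ge _ hpl (by omega), Int.cast_zero]
  have hf : frobeniusFunctional K p ℓ (g₃ * (X 0 ^ 7 + X 1 ^ 7) ^ (4 * k + 2)) = 0 := by
    have hexp : 4 * k + 2 = ℓ + p * (4 * ℓ + 1) := by rw [hk, hpl]; ring
    rw [hexp, pow_add, ← mul_assoc, frobeniusFunctional_mul_pow_eq_zero hp]
  have h := congrArg (frobeniusFunctional K p ℓ) h₁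
  rw [map_add, map_add, hx, hy, hf, add_zero, add_zero, frobeniusFunctional_X_pow_mul_X_pow,
    frobeniusWeight_three_mul_sq hp.pos hpl] at h
  have hfac : ((3 * ℓ).factorial : K) ≠ 0 := by
    rw [Ne, CharP.cast_eq_zero_iff K p, hp.dvd_factorial]; omega
  have hchoose : ((2 * ℓ).choose ℓ : K) ≠ 0 := by
    rw [Ne, CharP.cast_eq_zero_iff K p]
    intro hdvd
    have := hp.dvd_factorial.1 (hdvd.trans
      ((Nat.choose_mul_factorial_mul_factorial (show ℓ ≤ 2 * ℓ by omega)).symm ▸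
        Dvd.intro _ (mul_assoc _ _ _).symm))
    omega
  push_cast at h
  simp [hfac, hchoose] at h
end
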